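/- Let k be a field and let X be a scheme of finite type over k. If every pair of points p, q of X is contained in a common open subscheme U of X that is separated over k, then X is separated over k. -/

import Mathlib

open AlgebraicGeometry CategoryTheory

universe u

/-- The uniqueness part of the valuative criterion holds for `f : X ⟶ Y` as soon as any two points
of `X` lie in a common open subscheme on which `f` satisfies it: a morphism from the spectrum of a
local ring factors through every open subscheme containing the image of the closed point. -/
theorem valuativeCriterion_uniqueness_of_pairwise_opens {X Y : Scheme.{u}} (f : X ⟶ Y)
    (h : ∀ p q : X, ∃ U : X.Opens, p ∈ U ∧ q ∈ U ∧ ValuativeCriterion.Uniqueness (U.ι ≫ f)) :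
    ValuativeCriterion.Uniqueness f := by
  refine fun S ↦ ⟨fun ⟨l₁, hl₁, hl₁'⟩ ⟨l₂, hl₂, hl₂'⟩ ↦ ?_⟩
  obtain ⟨U, h₁, h₂, hU⟩ :=
    h (l₁ (IsLocalRing.closedPoint S.R)) (l₂ (IsLocalRing.closedPoint S.R))
  have range_subset (l : Spec (.of S.R) ⟶ X) (hl : l (IsLocalRing.closedPoint S.R) ∈ U) :
      Set.range l ⊆ Set.range U.ι := by
    rintro _ ⟨x, rfl⟩
    rw [Scheme.Opens.range_ι]
    exact ((IsLocalRing.specializes_closedPoint x).map l.continuous).mem_open U.isOpen hl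
  let m₁ := IsOpenImmersion.lift U.ι l₁ (range_subset l₁ h₁)
  let m₂ := IsOpenImmersion.lift U.ι l₂ (range_subset l₂ h₂)
  have hm₁ : m₁ ≫ U.ι = l₁ := IsOpenImmersion.lift_fac _ _ _
  have hm₂ : m₂ ≫ U.ι = l₂ := IsOpenImmersion.lift_fac _ _ _
  let φ := Spec.map (CommRingCat.ofHom (algebraMap S.R S.K))
  have hφ : φ ≫ m₂ = φ ≫ m₁ := by
    rw [← cancel_mono U.ι, Category.assoc, Category.assoc, hm₁, hm₂]
    exact hl₂.trans hl₁.symm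
  have hf₁ : m₁ ≫ U.ι ≫ f = S.i₂ := by rw [← Category.assoc, hm₁, hl₁']
  have hf₂ : m₂ ≫ U.ι ≫ f = S.i₂ := by rw [← Category.assoc, hm₂, hl₂']
  let T : ValuativeCommSq (U.ι ≫ f) :=
    ⟨S.R, S.K, φ ≫ m₁, S.i₂, ⟨by rw [Category.assoc, hf₁]⟩⟩
  have : Subsingleton T.commSq.LiftStruct := hU T
  let t₁ : T.commSq.LiftStruct := ⟨m₁, rfl, hf₁⟩
  let t₂ : T.commSq.LiftStruct := ⟨m₂, hφ, hf₂⟩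
  have hm : m₁ = m₂ := congrArg CommSq.LiftStruct.l (Subsingleton.elim t₁ t₂)
  ext : 1
  change l₁ = l₂
  rw [← hm₁, ← hm₂, hm]

/-- A quasi-separated morphism `f : X ⟶ Y` is separated if any two points of `X` lie in a common
open subscheme that is separated over `Y`. -/
theorem isSeparated_of_pairwise_opens {X Y : Scheme.{u}} (f : X ⟶ Y) [QuasiSeparated f]
    (h : ∀ p q : X, ∃ U : X.Opens, p ∈ U ∧ q ∈ U ∧ IsSeparated (U.ι ≫ f)) :
    IsSeparated f :=
  .of_valuativeCriterion f <| valuativeCriterion_uniqueness_of_pairwise_opens f fun p q ↦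
    let ⟨U, hp, hq, hU⟩ := h p q
    ⟨U, hp, hq, hU.valuativeCriterion⟩

/-- Let `k` be a field and `X` a scheme of finite type over `k` (i.e. the structure morphism
`f : X ⟶ Spec k` is locally of finite type and quasi-compact). If every pair of points `p, q` of
`X` is contained in a common open subscheme `U` of `X` that is separated over `k`, then `X` is
separated over `k`. -/
theorem separated_of_pairwise_separated_opens
    (k : Type u) [Field k] (X : Scheme.{u}) (f : X ⟶ Spec (CommRingCat.of k))
    [LocallyOfFiniteType f] [QuasiCompact f]
    (h : ∀ p q : X, ∃ U : X.Opens, p ∈ U ∧ q ∈ U ∧ IsSeparated (U.ι ≫ f)) :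
    IsSeparated f := by
  have : IsLocallyNoetherian X := LocallyOfFiniteType.isLocallyNoetherian f
  exact isSeparated_of_pairwise_opens f h
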